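/- Let Ω ⊂ ℝⁿ be a bounded open set and suppose the Orlicz–Sobolev inequality ‖v‖_{L^ϕ(Ω,dμ)} ≤ C₀ ‖∇_A v‖_{L²(Ω,dμ)} holds for every pair (v, ∇_A v) ∈ (W_A^{1,2})₀(Ω), where ϕ(t) = Φ_N(t²) and Φ_N is the Orlicz bump function with some N > 1. Let f ∈ L^∞(Ω) and let u be a weak solution of ∇·A∇u = f in Ω with A-gradient G = ∇_A u, and assume that for every sign ε ∈ {+1,−1} and every constant c ≥ 0 the truncation pair ((εu − c)₊, 1_{εu>c} εG) belongs to (W_A^{1,2})₀(Ω). Then ess sup_Ω |u| ≤ C‖f‖_{L^∞(Ω)} for a constant C independent of f and u. -/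

import Mathlib

open MeasureTheory Filter Topology Set Matrix ENNReal NNReal

noncomputable section

/-- Vectors in `ℝⁿ`. -/
abbrev Vec (n : ℕ) := Fin n → ℝ

/-- The (pointwise) gradient of a real valued function on `ℝⁿ`, via `fderiv`
(junk value `0` at points of non-differentiability). -/
noncomputable def grad {n : ℕ} (w : Vec n → ℝ) (x : Vec n) : Vec n :=
  fun i => fderiv ℝ w x (Pi.single i 1)

/-- The `A`-gradient `∇_A w = B ∇w`, where `A = BᵀB`. -/
noncomputable def Agrad {n : ℕ} (Bm : Vec n → Matrix (Fin n) (Fin n) ℝ)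
    (w : Vec n → ℝ) (x : Vec n) : Vec n :=
  (Bm x) *ᵥ (grad w x)

/-- Lipschitz function with compact support contained in `Ω`. -/
def IsLipCpt {n : ℕ} (Ω : Set (Vec n)) (w : Vec n → ℝ) : Prop :=
  (∃ L, LipschitzWith L w) ∧ HasCompactSupport w ∧ tsupport w ⊆ Ω

/-- Squared euclidean norm of a vector in `ℝⁿ`. -/
noncomputable def sqNorm {n : ℕ} (v : Vec n) : ℝ := ∑ i, (v i) ^ 2

/-- Squared `L²(Ω)` distance of two scalar functions. -/
noncomputable def l2dist {n : ℕ} (Ω : Set (Vec n)) (f g : Vec n → ℝ) : ℝ≥0∞ :=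
  ∫⁻ x in Ω, ENNReal.ofReal ((f x - g x) ^ 2)

/-- Squared `L²(Ω;ℝⁿ)` distance of two vector valued functions. -/
noncomputable def l2distV {n : ℕ} (Ω : Set (Vec n)) (F G : Vec n → Vec n) : ℝ≥0∞ :=
  ∫⁻ x in Ω, ENNReal.ofReal (sqNorm (fun i => F x i - G x i))

/-- The pair `(u, G)` belongs to the degenerate Sobolev space `(W_A^{1,2})₀(Ω)`:
`u ∈ L²(Ω)`, `G ∈ L²(Ω;ℝⁿ)` and there are compactly supported Lipschitz functions `w k`
with `w k → u` in `L²(Ω)` and `B ∇(w k) → G` in `L²(Ω;ℝⁿ)`. -/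
def MemW12zero {n : ℕ} (Ω : Set (Vec n)) (Bm : Vec n → Matrix (Fin n) (Fin n) ℝ)
    (u : Vec n → ℝ) (G : Vec n → Vec n) : Prop :=
  AEMeasurable u (volume.restrict Ω) ∧ AEMeasurable G (volume.restrict Ω) ∧
  (∫⁻ x in Ω, ENNReal.ofReal ((u x) ^ 2)) < ⊤ ∧
  (∫⁻ x in Ω, ENNReal.ofReal (sqNorm (G x))) < ⊤ ∧
  ∃ w : ℕ → Vec n → ℝ,
    (∀ k, IsLipCpt Ω (w k)) ∧
    Tendsto (fun k => l2dist Ω (w k) u) atTop (𝓝 0) ∧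
    Tendsto (fun k => l2distV Ω (fun x => Agrad Bm (w k) x) G) atTop (𝓝 0)

/-- `u` (with `A`-gradient `G`) is a weak solution of `∇·A∇u = f` in `Ω`. -/
def IsWeakSol {n : ℕ} (Ω : Set (Vec n)) (Bm : Vec n → Matrix (Fin n) (Fin n) ℝ)
    (f u : Vec n → ℝ) (G : Vec n → Vec n) : Prop :=
  MemW12zero Ω Bm u G ∧
  ∀ φ : Vec n → ℝ, IsLipCpt Ω φ →
    (∫ x in Ω, ∑ i, G x i * Agrad Bm φ x i) = - ∫ x in Ω, f x * φ x

/-- `B` is a bounded Lipschitz matrix valued function. -/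
def BoundedLipMatrix {n : ℕ} (Bm : Vec n → Matrix (Fin n) (Fin n) ℝ) : Prop :=
  (∃ M : ℝ, ∀ x i j, |Bm x i j| ≤ M) ∧
  (∃ L : NNReal, ∀ i j, LipschitzWith L (fun x => Bm x i j))

/-- The normalized measure `dμ = dx/|Ω|` on `Ω`. -/
noncomputable def normMeasure {n : ℕ} (Ω : Set (Vec n)) : Measure (Vec n) :=
  (volume Ω)⁻¹ • volume.restrict Ω

/-- The convex conjugate (Legendre transform) `θ̃(t) = sup_s (st − θ(s))` of a
`[0,∞]`-valued function, computed with truncated subtraction in `[0,∞]`. -/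
noncomputable def youngConj (θ : ℝ → ℝ≥0∞) (t : ℝ) : ℝ≥0∞ :=
  ⨆ s : ℝ, ENNReal.ofReal (s * t) - θ s

/-- `θ : ℝ → [0,∞]` is a Young function. -/
structure IsYoung (θ : ℝ → ℝ≥0∞) : Prop where
  convex : ∀ x y a b : ℝ, 0 ≤ a → 0 ≤ b → a + b = 1 →
    θ (a * x + b * y) ≤ ENNReal.ofReal a * θ x + ENNReal.ofReal b * θ y
  lsc : LowerSemicontinuous θ
  even : ∀ t, θ (-t) = θ t
  zero : θ 0 = 0
  nontrivial : ∃ t > 0, θ t ≠ 0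
  conj_nontrivial : ∃ t > 0, youngConj θ t ≠ 0

/-- The Luxemburg norm `‖f‖_{L^θ(μ)} = inf {k > 0 : ∫ θ(f/k) dμ ≤ 1}`, with `inf ∅ = ∞`. -/
noncomputable def luxNorm {α : Type*} [MeasurableSpace α] (θ : ℝ → ℝ≥0∞)
    (μ : Measure α) (f : α → ℝ) : ℝ≥0∞ :=
  sInf (ENNReal.ofReal '' {k : ℝ | 0 < k ∧ ∫⁻ x, θ (f x / k) ∂μ ≤ 1})

/-- The Orlicz bump function `Φ_N`: `Φ_N(t) = t (ln t)^N` for `t ≥ e^{2N}` and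
`Φ_N(t) = (2N)^N t` for `0 ≤ t ≤ e^{2N}`, extended evenly. -/
noncomputable def orliczBump (N : ℝ) (t : ℝ) : ℝ≥0∞ :=
  if |t| ≤ Real.exp (2 * N) then ENNReal.ofReal ((2 * N) ^ N * |t|)
  else ENNReal.ofReal (|t| * Real.log |t| ^ N)

end

lemma bump_ptwise {N j : ℝ} (hN : 1 < N) (hj : 2 * N ≤ j) {t : ℝ} (ht : 0 ≤ t) :
    ENNReal.ofReal t ≤ ENNReal.ofReal (Real.exp j) +
      ENNReal.ofReal (j ^ (-N)) * orliczBump N t := by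
  rcases le_or_gt t (Real.exp j) with h | h
  · exact le_trans (ENNReal.ofReal_le_ofReal h) le_self_add
  · have h2 : Real.exp (2 * N) < t := lt_of_le_of_lt (Real.exp_le_exp.mpr hj) h
    have hj0 : 0 < j := by linarith
    refine le_trans ?_ le_add_self
    unfold orliczBump
    rw [abs_of_nonneg ht, if_neg (not_le.mpr h2), ← ENNReal.ofReal_mul (by positivity)]
    apply ENNReal.ofReal_le_ofReal
    have hlog : j ≤ Real.log t := by
      rw [Real.le_log_iff_exp_le (lt_trans (Real.exp_pos _) h)]; exact h.le
    have h3 : j ^ N ≤ Real.log t ^ N := Real.rpow_le_rpow hj0.le hlog (by linarith)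
    have h4 : j ^ (-N) * j ^ N = 1 := by
      rw [← Real.rpow_add hj0]; simp
    have h5 : 0 ≤ j ^ (-N) := by positivity
    calc t = t * (j ^ (-N) * j ^ N) := by rw [h4, mul_one]
      _ ≤ t * (j ^ (-N) * Real.log t ^ N) := by gcongr
      _ = _ := by ring

lemma lux_step {α : Type*} [MeasurableSpace α] (μ : Measure α) {N j p R : ℝ} (hN : 1 < N)
    (hj : 2 * N ≤ j) (hR : 0 ≤ R) (hp : 0 ≤ p) (v : α → ℝ) (E : Set α)
    (hE : NullMeasurableSet E μ) (hv : ∀ x, x ∉ E → v x = 0)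
    (hm : μ E ≤ ENNReal.ofReal p)
    (hl : luxNorm (fun t => orliczBump N (t ^ 2)) μ v ≤ ENNReal.ofReal R) :
    ∫⁻ x, ENNReal.ofReal ((v x) ^ 2) ∂μ ≤
      ENNReal.ofReal (R ^ 2 * (Real.exp j * p + j ^ (-N))) := by
  have hj0 : 0 < j := by linarith
  have key : ∀ K : ℝ, R < K → ∫⁻ x, ENNReal.ofReal ((v x) ^ 2) ∂μ ≤
      ENNReal.ofReal (K ^ 2 * (Real.exp j * p + j ^ (-N))) := by
    intro K hK
    have h1 : luxNorm (fun t => orliczBump N (t ^ 2)) μ v < ENNReal.ofReal K :=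
      lt_of_le_of_lt hl ((ENNReal.ofReal_lt_ofReal_iff (by linarith)).mpr hK)
    unfold luxNorm at h1
    obtain ⟨_, ⟨k, ⟨hk0, hk⟩, rfl⟩, hkK⟩ := sInf_lt_iff.mp h1
    have hkK' : k < K := (ENNReal.ofReal_lt_ofReal_iff (by linarith)).mp hkK
    have hpt : ∀ x, ENNReal.ofReal ((v x) ^ 2) ≤ ENNReal.ofReal (k ^ 2) *
        (E.indicator (fun _ => ENNReal.ofReal (Real.exp j)) x +
          ENNReal.ofReal (j ^ (-N)) * orliczBump N ((v x / k) ^ 2)) := by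
      intro x
      by_cases hx : x ∈ E
      · rw [Set.indicator_of_mem hx]
        have := bump_ptwise hN hj (sq_nonneg (v x / k))
        calc ENNReal.ofReal ((v x) ^ 2)
            = ENNReal.ofReal (k ^ 2) * ENNReal.ofReal ((v x / k) ^ 2) := by
              rw [← ENNReal.ofReal_mul (by positivity)]
              congr 1
              field_simp
          _ ≤ _ := by gcongr
      · simp [hv x hx]
    calc ∫⁻ x, ENNReal.ofReal ((v x) ^ 2) ∂μ
        ≤ ∫⁻ x, ENNReal.ofReal (k ^ 2) *
        (E.indicator (fun _ => ENNReal.ofReal (Real.exp j)) x +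
          ENNReal.ofReal (j ^ (-N)) * orliczBump N ((v x / k) ^ 2)) ∂μ := lintegral_mono hpt
      _ = ENNReal.ofReal (k ^ 2) * (∫⁻ x, E.indicator (fun _ => ENNReal.ofReal (Real.exp j)) x ∂μ
          + ENNReal.ofReal (j ^ (-N)) * ∫⁻ x, orliczBump N ((v x / k) ^ 2) ∂μ) := by
        rw [lintegral_const_mul' _ _ ENNReal.ofReal_ne_top, lintegral_add_left',
          lintegral_const_mul' _ _ ENNReal.ofReal_ne_top]
        exact aemeasurable_const.indicator₀ hE
      _ ≤ ENNReal.ofReal (k ^ 2) * (ENNReal.ofReal (Real.exp j) * ENNReal.ofReal p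
          + ENNReal.ofReal (j ^ (-N)) * 1) := by
        gcongr
        exact (lintegral_indicator_const_le _ _).trans (by gcongr)
      _ = ENNReal.ofReal (k ^ 2 * (Real.exp j * p + j ^ (-N))) := by
        rw [mul_one, ← ENNReal.ofReal_mul (by positivity),
          ← ENNReal.ofReal_add (by positivity) (by positivity),
          ← ENNReal.ofReal_mul (by positivity)]
      _ ≤ _ := by
        apply ENNReal.ofReal_le_ofReal
        gcongr
  have ht : Tendsto (fun K : ℝ => ENNReal.ofReal (K ^ 2 * (Real.exp j * p + j ^ (-N))))
      (𝓝[>] R) (𝓝 (ENNReal.ofReal (R ^ 2 * (Real.exp j * p + j ^ (-N))))) := by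
    apply Tendsto.mono_left _ nhdsWithin_le_nhds
    apply Continuous.tendsto
    exact ENNReal.continuous_ofReal.comp (by fun_prop)
  refine ge_of_tendsto ht ?_
  filter_upwards [self_mem_nhdsWithin] with K hK using key K hK

/-- Cauchy-Schwarz on the support. -/
lemma cs_step {α : Type*} [MeasurableSpace α] (μ : Measure α) [IsFiniteMeasure μ]
    {p : ℝ} (hp : 0 ≤ p) (v : α → ℝ) (E : Set α) (hv2 : MemLp v 2 μ)
    (hE : NullMeasurableSet E μ) (hv : ∀ x, x ∉ E → v x = 0)
    (hm : μ E ≤ ENNReal.ofReal p) :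
    (∫ x, v x ∂μ) ^ 2 ≤ p * ∫ x, (v x) ^ 2 ∂μ := by
  have hv1 : Integrable v μ := hv2.integrable (by norm_num)
  have hvs : Integrable (fun x => (v x) ^ 2) μ := hv2.integrable_sq
  have hq : ∀ s : ℝ, 0 ≤ (∫ x, (v x) ^ 2 ∂μ) - 2 * s * (∫ x, v x ∂μ) + s ^ 2 * p := by
    intro s
    have hi : Integrable (E.indicator (fun _ => s ^ 2)) μ :=
      (integrable_const _).indicator₀ hE
    have h1 : 0 ≤ ∫ x, ((v x) ^ 2 - 2 * s * v x + E.indicator (fun _ => s ^ 2) x) ∂μ := by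
      apply integral_nonneg
      intro x
      by_cases hx : x ∈ E
      · simp only [Set.indicator_of_mem hx, Pi.zero_apply]
        nlinarith [sq_nonneg (v x - s)]
      · simp [hv x hx, hx]
    have hi2 : Integrable (fun x => (v x) ^ 2 - 2 * s * v x) μ := hvs.sub (hv1.const_mul _)
    rw [integral_add hi2 hi, integral_sub hvs (hv1.const_mul _),
      integral_const_mul, integral_indicator₀ hE, setIntegral_const, smul_eq_mul] at h1
    have h2 : μ.real E ≤ p := ENNReal.toReal_le_of_le_ofReal hp hm
    nlinarith [sq_nonneg s]
  set I := ∫ x, v x ∂μ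
  set J := ∫ x, (v x) ^ 2 ∂μ
  have hd := discrim_le_zero (a := p) (b := -2 * I) (c := J)
    (fun s => by have := hq s; nlinarith)
  unfold discrim at hd
  nlinarith

lemma level_step {α : Type*} [MeasurableSpace α] (μ : Measure α) [IsFiniteMeasure μ]
    {N C₀ M : ℝ} (hN : 1 < N) (hC₀ : 0 ≤ C₀) (hM : 0 ≤ M) (U : α → ℝ) (hU : AEMeasurable U μ)
    (c : ℝ) (hv2 : MemLp (fun x => max (U x - c) 0) 2 μ)
    (hl : luxNorm (fun t => orliczBump N (t ^ 2)) μ (fun x => max (U x - c) 0) ≤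
      ENNReal.ofReal C₀ * (ENNReal.ofReal (M * ∫ x, max (U x - c) 0 ∂μ)) ^ (1/2 : ℝ))
    {j p : ℝ} (hj : 2 * N ≤ j) (hp : 0 ≤ p) (hm : μ {x | c < U x} ≤ ENNReal.ofReal p) :
    ∫ x, max (U x - c) 0 ∂μ ≤ p * (Real.exp j * p + j ^ (-N)) * (C₀ ^ 2 * M) := by
  have hj0 : 0 < j := by linarith
  have hE : NullMeasurableSet {x | c < U x} μ := nullMeasurableSet_lt aemeasurable_const hU
  have hv : ∀ x, x ∉ {x | c < U x} → max (U x - c) 0 = 0 := by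
    intro x hx
    simp only [Set.mem_ofPred_eq, not_lt] at hx
    exact max_eq_right (by linarith)
  set I := ∫ x, max (U x - c) 0 ∂μ with hI
  have hI0 : 0 ≤ I := integral_nonneg (fun x => le_max_right _ _)
  rw [ENNReal.ofReal_rpow_of_nonneg (by positivity) (by norm_num),
    ← ENNReal.ofReal_mul hC₀] at hl
  have h1 := lux_step μ hN hj (by positivity) hp _ _ hE hv hm hl
  have h2 := cs_step μ hp _ _ hv2 hE hv hm
  rw [← ofReal_integral_eq_lintegral_ofReal hv2.integrable_sq
    (Filter.Eventually.of_forall fun x => sq_nonneg _),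
    ENNReal.ofReal_le_ofReal_iff (by positivity), mul_pow, ← Real.sqrt_eq_rpow,
    Real.sq_sqrt (by positivity)] at h1
  rw [← hI] at h2
  rcases hI0.eq_or_lt with h0 | h0
  · rw [← h0]; positivity
  · have h3 : I * I ≤ I * (p * (Real.exp j * p + j ^ (-N)) * (C₀ ^ 2 * M)) := by
      calc I * I = I ^ 2 := by ring
        _ ≤ _ := h2
        _ ≤ _ := mul_le_mul_of_nonneg_left h1 hp
        _ = _ := by ring
    exact le_of_mul_le_mul_left h3 h0

lemma cheb_step {α : Type*} [MeasurableSpace α] (μ : Measure α) [IsFiniteMeasure μ]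
    (U : α → ℝ) (c d q : ℝ) (hcd : c < d) 
    (hv : Integrable (fun x => max (U x - c) 0) μ)
    (h : ∫ x, max (U x - c) 0 ∂μ ≤ (d - c) * q) : μ {x | d < U x} ≤ ENNReal.ofReal q := by
  have h1 := mul_meas_ge_le_integral_of_nonneg (μ := μ)
    (Filter.Eventually.of_forall fun x => le_max_right (U x - c) 0) hv (d - c)
  have h2 : μ.real {x | d - c ≤ max (U x - c) 0} ≤ q :=
    le_of_mul_le_mul_left (h1.trans h) (by linarith)
  have h3 : μ {x | d < U x} ≤ μ {x | d - c ≤ max (U x - c) 0} := by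
    apply measure_mono
    intro x hx
    simp only [Set.mem_ofPred_eq] at hx ⊢
    exact le_max_of_le_left (by linarith)
  refine h3.trans ?_
  rw [← ENNReal.ofReal_toReal (measure_ne_top μ _)]
  exact ENNReal.ofReal_le_ofReal h2

lemma core_bound {N C₀ : ℝ} (hN : 1 < N) (hC₀ : 0 < C₀) :
    ∃ C : ℝ, 0 < C ∧ ∀ {α : Type} [MeasurableSpace α] (μ : Measure α) [IsProbabilityMeasure μ]
      (M : ℝ) (_ : 0 < M) (U : α → ℝ) (_ : AEMeasurable U μ)
      (_ : ∀ c, 0 ≤ c → MemLp (fun x => max (U x - c) 0) 2 μ)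
      (_ : ∀ c, 0 ≤ c →
        luxNorm (fun t => orliczBump N (t ^ 2)) μ (fun x => max (U x - c) 0) ≤
        ENNReal.ofReal C₀ * (ENNReal.ofReal (M * ∫ x, max (U x - c) 0 ∂μ)) ^ (1/2 : ℝ)),
      ∀ᵐ x ∂μ, U x ≤ C * M := by
  obtain ⟨j₀, hj₀⟩ := exists_nat_ge (2 * N)
  have hj0 : (0:ℝ) < j₀ := by linarith
  let a : ℕ → ℝ := fun k => Real.exp (-((k + j₀ : ℕ) : ℝ)) + ((k + j₀ : ℕ) : ℝ) ^ (-N)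
  have ha : ∀ k, 0 < a k := fun k => by positivity
  have hs : Summable a := by
    apply Summable.add
    · exact (_root_.summable_nat_add_iff j₀ (f := fun k : ℕ => Real.exp (-(k:ℝ)))).mpr Real.summable_exp_neg_nat
    · exact (_root_.summable_nat_add_iff j₀ (f := fun k : ℕ => (k:ℝ) ^ (-N))).mpr
        (Real.summable_nat_rpow.mpr (by linarith))
  let b : ℝ := Real.exp (2 * j₀) * (Real.exp j₀ * 1 + (j₀ : ℝ) ^ (-N)) * C₀ ^ 2
  have hb : 0 < b := by positivity
  let s : ℕ → ℝ := fun k => b + ∑ i ∈ Finset.range k, Real.exp 2 * a i * C₀ ^ 2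
  have hs0 : ∀ k, 0 < s k := fun k => by
    have : 0 ≤ ∑ i ∈ Finset.range k, Real.exp 2 * a i * C₀ ^ 2 :=
      Finset.sum_nonneg fun i _ => by have := ha i; positivity
    simp only [s]; linarith
  have hs' : Summable (fun i => Real.exp 2 * a i * C₀ ^ 2) := (hs.mul_left _).mul_right _
  refine ⟨b + ∑' i, Real.exp 2 * a i * C₀ ^ 2, ?_, ?_⟩
  · have : 0 ≤ ∑' i, Real.exp 2 * a i * C₀ ^ 2 :=
      tsum_nonneg fun i => by have := ha i; positivity
    linarith
  intro α _ μ _ M hM U hU hv2 hl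
  have claim : ∀ k : ℕ, μ {x | s k * M < U x} ≤
      ENNReal.ofReal (Real.exp (-2 * ((k + j₀ : ℕ) : ℝ))) := by
    intro k
    induction k with
    | zero =>
      have hs00 : s 0 = b := by simp [s]
      rw [hs00]
      have h1 := level_step μ hN hC₀.le hM.le U hU 0 (hv2 0 le_rfl) (hl 0 le_rfl) hj₀
        zero_le_one (by simpa using prob_le_one)
      apply cheb_step μ U 0 (b * M) _ (by positivity) ((hv2 0 le_rfl).integrable (by norm_num))
      refine h1.trans (le_of_eq ?_)
      have he : Real.exp (2 * (j₀:ℝ)) * Real.exp (-2 * (j₀:ℝ)) = 1 := by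
        rw [← Real.exp_add]; simp
      simp only [b, zero_add]
      linear_combination (-(Real.exp j₀ * 1 + (j₀ : ℝ) ^ (-N)) * C₀ ^ 2 * M) * he
    | succ k ih =>
      have hc : 0 ≤ s k * M := by have := hs0 k; positivity
      have hjk : 2 * N ≤ ((k + j₀ : ℕ) : ℝ) := by
        push_cast; have : (0:ℝ) ≤ k := by positivity
        linarith
      have h1 := level_step μ hN hC₀.le hM.le U hU _ (hv2 _ hc) (hl _ hc) hjk
        (Real.exp_pos _).le ih
      have hss : s (k+1) = s k + Real.exp 2 * a k * C₀ ^ 2 := by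
        simp only [s, Finset.sum_range_succ]; ring
      have hak := ha k
      apply cheb_step μ U (s k * M) (s (k+1) * M) _ ?_ ((hv2 _ hc).integrable (by norm_num))
      · refine h1.trans (le_of_eq ?_)
        have he : Real.exp 2 * Real.exp (-2 * ((k + 1 + j₀ : ℕ) : ℝ))
            = Real.exp (-2 * ((k + j₀ : ℕ) : ℝ)) := by
          rw [← Real.exp_add]; congr 1; push_cast; ring
        have he2 : Real.exp ((k + j₀ : ℕ) : ℝ) * Real.exp (-2 * ((k + j₀ : ℕ) : ℝ))
            = Real.exp (-((k + j₀ : ℕ) : ℝ)) := by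
          rw [← Real.exp_add]; congr 1; ring
        rw [he2, hss]
        change _ * a k * _ = _
        linear_combination (-a k * C₀ ^ 2 * M) * he
      · rw [hss]
        have : 0 < Real.exp 2 * a k * C₀ ^ 2 * M := by positivity
        linarith
  have hle : ∀ k, s k ≤ b + ∑' i, Real.exp 2 * a i * C₀ ^ 2 := fun k => by
    have := hs'.sum_le_tsum (Finset.range k) (fun i _ => by have := ha i; positivity)
    simp only [s]; linarith
  rw [ae_iff]
  simp only [not_le]
  have ht : Tendsto (fun k : ℕ => ENNReal.ofReal (Real.exp (-2 * ((k + j₀ : ℕ) : ℝ)))) atTop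
      (𝓝 0) := by
    rw [← ENNReal.ofReal_zero]
    apply ENNReal.tendsto_ofReal
    apply Real.tendsto_exp_atBot.comp
    apply Tendsto.const_mul_atTop_of_neg (by norm_num)
    exact tendsto_natCast_atTop_atTop.comp (tendsto_add_atTop_nat j₀)
  refine le_antisymm (ge_of_tendsto ht (Filter.Eventually.of_forall fun k => ?_)) bot_le
  refine le_trans (measure_mono fun x hx => ?_) (claim k)
  simp only [Set.mem_ofPred_eq] at hx ⊢
  exact lt_of_le_of_lt (mul_le_mul_of_nonneg_right (hle k) hM.le) hx

lemma eLpNorm_two_eq' {α : Type*} [MeasurableSpace α] (μ : Measure α) (h : α → ℝ) :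
    eLpNorm h 2 μ = (∫⁻ x, ENNReal.ofReal ((h x) ^ 2) ∂μ) ^ (1/2 : ℝ) := by
  rw [eLpNorm_eq_lintegral_rpow_enorm_toReal (by norm_num) (by norm_num)]
  simp only [ENNReal.toReal_ofNat]
  congr 1
  apply lintegral_congr
  intro x
  rw [← sq_abs, ENNReal.ofReal_pow (abs_nonneg _), ← Real.enorm_eq_ofReal_abs]
  norm_cast

lemma memLp_two_of {α : Type*} [MeasurableSpace α] {μ : Measure α} {h : α → ℝ}
    (hm : AEMeasurable h μ) (hf : ∫⁻ x, ENNReal.ofReal ((h x) ^ 2) ∂μ < ⊤) : MemLp h 2 μ := by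
  refine ⟨hm.aestronglyMeasurable, ?_⟩
  rw [eLpNorm_two_eq']
  exact ENNReal.rpow_lt_top_of_nonneg (by norm_num) hf.ne

lemma pairing_tendsto {α : Type*} [MeasurableSpace α] {μ : Measure α} {g h : α → ℝ}
    {hk : ℕ → α → ℝ} (hg : MemLp g 2 μ) (hh : MemLp h 2 μ) (hkm : ∀ k, AEMeasurable (hk k) μ)
    (ht : Tendsto (fun k => ∫⁻ x, ENNReal.ofReal ((hk k x - h x) ^ 2) ∂μ) atTop (𝓝 0)) :
    (∀ᶠ k in atTop, Integrable (fun x => g x * hk k x) μ) ∧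
    Tendsto (fun k => ∫ x, g x * hk k x ∂μ) atTop (𝓝 (∫ x, g x * h x ∂μ)) := by
  have hint : ∀ᶠ k in atTop, Integrable (fun x => g x * hk k x) μ := by
    filter_upwards [ht.eventually (gt_mem_nhds ENNReal.zero_lt_top)] with k hk'
    have h1 : MemLp (fun x => hk k x - h x) 2 μ :=
      memLp_two_of ((hkm k).sub hh.1.aemeasurable) hk'
    have h2 : MemLp (hk k) 2 μ := by
      have := h1.add hh
      refine this.ae_eq (Filter.Eventually.of_forall fun x => ?_)
      simp
    exact hg.integrable_mul h2
  refine ⟨hint, ?_⟩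
  refine tendsto_integral_of_L1 _ (hg.integrable_mul hh).1 hint ?_
  have hb : ∀ k, ∫⁻ x, ‖g x * hk k x - (g * h) x‖ₑ ∂μ ≤
      eLpNorm g 2 μ * (∫⁻ x, ENNReal.ofReal ((hk k x - h x) ^ 2) ∂μ) ^ (1/2 : ℝ) := by
    intro k
    have := eLpNorm_smul_le_mul_eLpNorm (p := 2) (q := 2) (r := 1) (μ := μ)
      (f := fun x => hk k x - h x) (φ := g)
      ((hkm k).sub hh.1.aemeasurable).aestronglyMeasurable hg.1
    rw [eLpNorm_one_eq_lintegral_enorm, eLpNorm_two_eq' μ (fun x => hk k x - h x)] at this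
    refine le_trans (le_of_eq (lintegral_congr fun x => ?_)) this
    simp only [Pi.mul_apply, Pi.smul_apply', smul_eq_mul, mul_sub]
  refine tendsto_of_tendsto_of_tendsto_of_le_of_le tendsto_const_nhds ?_ (fun _ => bot_le) hb
  have h3 : Tendsto (fun k => (∫⁻ x, ENNReal.ofReal ((hk k x - h x) ^ 2) ∂μ) ^ (1/2 : ℝ)) atTop
      (𝓝 0) := by
    have := (ENNReal.continuous_rpow_const (y := (1/2:ℝ))).tendsto 0 |>.comp ht
    simpa [Function.comp_def] using this
  have := ENNReal.Tendsto.const_mul (a := eLpNorm g 2 μ) h3 (Or.inr hg.2.ne)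
  simpa using this

lemma agrad_measurable {n : ℕ} {Bm : Vec n → Matrix (Fin n) (Fin n) ℝ}
    (hBm : BoundedLipMatrix Bm) (w : Vec n → ℝ) (i : Fin n) :
    Measurable (fun x => Agrad Bm w x i) := by
  obtain ⟨-, L, hL⟩ := hBm
  unfold Agrad Matrix.mulVec dotProduct grad
  refine Finset.measurable_sum _ fun j _ => ?_
  exact (hL i j).continuous.measurable.mul (measurable_fderiv_apply_const ℝ w _)

lemma comp_memLp {n : ℕ} {μ : Measure (Vec n)} {G : Vec n → Vec n} (hG : AEMeasurable G μ)
    (hf : ∫⁻ x, ENNReal.ofReal (sqNorm (G x)) ∂μ < ⊤) (i : Fin n) :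
    MemLp (fun x => G x i) 2 μ := by
  refine memLp_two_of ((measurable_pi_apply i).comp_aemeasurable hG) (lt_of_le_of_lt ?_ hf)
  refine lintegral_mono fun x => ENNReal.ofReal_le_ofReal ?_
  exact Finset.single_le_sum (f := fun i => (G x i) ^ 2) (fun j _ => sq_nonneg _)
    (Finset.mem_univ i)

/-- The weak formulation extends to all of `(W_A^{1,2})₀(Ω)`. -/
lemma weak_extend {n : ℕ} {Ω : Set (Vec n)} {Bm : Vec n → Matrix (Fin n) (Fin n) ℝ}
    (hBm : BoundedLipMatrix Bm) {f u : Vec n → ℝ} {G : Vec n → Vec n}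
    (hf : MemLp f 2 (volume.restrict Ω)) (hu : IsWeakSol Ω Bm f u G)
    {v : Vec n → ℝ} {H : Vec n → Vec n} (hv : MemW12zero Ω Bm v H) :
    (∫ x in Ω, ∑ i, G x i * H x i) = - ∫ x in Ω, f x * v x := by
  obtain ⟨⟨-, hGm, -, hG2, -⟩, hweak⟩ := hu
  obtain ⟨hvm, hHm, hv2, hH2, w, hw, hwv, hwH⟩ := hv
  have hcomp : ∀ i, _ := fun i => pairing_tendsto (comp_memLp hGm hG2 i) (comp_memLp hHm hH2 i)
    (hk := fun k x => Agrad Bm (w k) x i) (fun k => (agrad_measurable hBm (w k) i).aemeasurable)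
    (by
      refine tendsto_of_tendsto_of_tendsto_of_le_of_le tendsto_const_nhds hwH
        (fun _ => bot_le) (fun k => ?_)
      refine lintegral_mono fun x => ENNReal.ofReal_le_ofReal ?_
      exact Finset.single_le_sum (f := fun i => (Agrad Bm (w k) x i - H x i) ^ 2)
        (fun j _ => sq_nonneg _) (Finset.mem_univ i))
  have hfv := (pairing_tendsto hf (memLp_two_of hvm hv2) (hk := w)
    (fun k => by
      obtain ⟨⟨L, hL⟩, -⟩ := hw k
      exact hL.continuous.measurable.aemeasurable) hwv).2
  have h1 : Tendsto (fun k => ∑ i, ∫ x in Ω, G x i * Agrad Bm (w k) x i) atTop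
      (𝓝 (∑ i, ∫ x in Ω, G x i * H x i)) :=
    tendsto_finsetSum _ fun i _ => (hcomp i).2
  have hi : ∀ i, Integrable (fun x => G x i * H x i) (volume.restrict Ω) := fun i =>
    (comp_memLp hGm hG2 i).integrable_mul (comp_memLp hHm hH2 i)
  rw [integral_finsetSum _ fun i _ => hi i]
  refine tendsto_nhds_unique h1 (Tendsto.congr' ?_ hfv.neg)
  filter_upwards [Filter.eventually_all.mpr fun i => (hcomp i).1] with k hk
  rw [← integral_finsetSum _ fun i _ => hk i]
  exact (hweak (w k) (hw k)).symm

/-- Energy estimate for the truncations. -/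
lemma energy_est {n : ℕ} {Ω : Set (Vec n)} {Bm : Vec n → Matrix (Fin n) (Fin n) ℝ}
    (hBm : BoundedLipMatrix Bm) {f u : Vec n → ℝ} {G : Vec n → Vec n}
    [IsFiniteMeasure (volume.restrict Ω)]
    (hf : MemLp f 2 (volume.restrict Ω)) (hu : IsWeakSol Ω Bm f u G)
    {M ε c : ℝ} (hM : ∀ᵐ x ∂(volume.restrict Ω), |f x| ≤ M) (hε : ε = 1 ∨ ε = -1)
    (hv : MemW12zero Ω Bm (fun x => max (ε * u x - c) 0)
            (Set.indicator {x | c < ε * u x} (fun x => fun i => ε * G x i))) :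
    ∫⁻ x in Ω, ENNReal.ofReal (sqNorm
      (Set.indicator {x | c < ε * u x} (fun x => fun i => ε * G x i) x)) ≤
      ENNReal.ofReal (M * ∫ x in Ω, max (ε * u x - c) 0) := by
  have h := weak_extend hBm hf hu hv
  have hε2 : ε * ε = 1 := by rcases hε with rfl | rfl <;> norm_num
  have hεa : |ε| = 1 := by rcases hε with rfl | rfl <;> norm_num
  obtain ⟨hvm, hHm, hv2, hH2, -⟩ := hv
  set H := Set.indicator {x | c < ε * u x} (fun x => fun i => ε * G x i) with hH
  have hpt : ∀ x, ∑ i, G x i * H x i = ε * sqNorm (H x) := by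
    intro x
    unfold sqNorm
    rw [Finset.mul_sum]
    refine Finset.sum_congr rfl fun i _ => ?_
    by_cases hx : x ∈ {x | c < ε * u x}
    · simp only [hH, Set.indicator_of_mem hx]
      linear_combination (-(G x i) ^ 2 * ε) * hε2
    · simp [hH, Set.indicator_of_notMem hx]
  simp_rw [hpt] at h
  rw [integral_const_mul] at h
  have hHi : Integrable (fun x => sqNorm (H x)) (volume.restrict Ω) := by
    unfold sqNorm
    exact integrable_finsetSum _ fun i _ => (comp_memLp hHm hH2 i).integrable_sq
  have hvL := memLp_two_of hvm hv2
  rw [← ofReal_integral_eq_lintegral_ofReal hHi (Filter.Eventually.of_forall fun x =>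
    Finset.sum_nonneg fun i _ => sq_nonneg _)]
  apply ENNReal.ofReal_le_ofReal
  have h2 : ∫ x in Ω, sqNorm (H x) = ∫ x in Ω, (-ε) * (f x * max (ε * u x - c) 0) := by
    rw [integral_const_mul]
    linear_combination ε * h - (∫ x in Ω, sqNorm (H x)) * hε2
  rw [h2, ← integral_const_mul]
  refine integral_mono_ae ((hf.integrable_mul hvL).const_mul _)
    ((hvL.integrable (by norm_num)).const_mul _) ?_
  filter_upwards [hM] with x hx
  have hm : 0 ≤ max (ε * u x - c) 0 := le_max_right _ _
  have h3 : -ε * f x ≤ M := by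
    calc -ε * f x ≤ |-ε * f x| := le_abs_self _
      _ = |f x| := by rw [abs_mul, abs_neg, hεa, one_mul]
      _ ≤ M := hx
  calc -ε * (f x * max (ε * u x - c) 0) = (-ε * f x) * max (ε * u x - c) 0 := by ring
    _ ≤ _ := mul_le_mul_of_nonneg_right h3 hm

/-- **Global boundedness.** Suppose the Orlicz–Sobolev inequality
`‖v‖_{L^ϕ(Ω,dμ)} ≤ C₀ ‖∇_A v‖_{L²(Ω,dμ)}` holds on `(W_A^{1,2})₀(Ω)` with
`ϕ(t) = Φ_N(t²)` for the Orlicz bump `Φ_N`, `N > 1`. Then there is a constant `C`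
(independent of `f` and `u`) such that any weak solution `u` of `∇·A∇u = f` with
`f ∈ L^∞(Ω)` whose truncations remain in `(W_A^{1,2})₀(Ω)` satisfies
`ess sup_Ω |u| ≤ C ‖f‖_{L^∞(Ω)}`. -/
theorem statement9 {n : ℕ} (Ω : Set (Vec n)) (hΩo : IsOpen Ω) (hΩb : Bornology.IsBounded Ω)
    (Bm : Vec n → Matrix (Fin n) (Fin n) ℝ) (hBm : BoundedLipMatrix Bm)
    (N : ℝ) (hN : 1 < N) (C₀ : ℝ)
    (hOS : ∀ w G, MemW12zero Ω Bm w G →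
      luxNorm (fun t => orliczBump N (t ^ 2)) (normMeasure Ω) w ≤ ENNReal.ofReal C₀ *
        (∫⁻ x, ENNReal.ofReal (sqNorm (G x)) ∂(normMeasure Ω)) ^ (1/2 : ℝ)) :
    ∃ C : ℝ, 0 < C ∧
      ∀ (f : Vec n → ℝ) (u : Vec n → ℝ) (G : Vec n → Vec n),
        AEMeasurable f (volume.restrict Ω) → eLpNorm f ⊤ (volume.restrict Ω) < ⊤ →
        IsWeakSol Ω Bm f u G →
        (∀ ε : ℝ, ε = 1 ∨ ε = -1 → ∀ c : ℝ, 0 ≤ c →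
          MemW12zero Ω Bm (fun x => max (ε * u x - c) 0)
            (Set.indicator {x | c < ε * u x} (fun x => fun i => ε * G x i))) →
        eLpNorm u ⊤ (volume.restrict Ω) ≤
          ENNReal.ofReal C * eLpNorm f ⊤ (volume.restrict Ω) := by
  have hfin : volume Ω ≠ ⊤ := hΩb.measure_lt_top.ne
  obtain ⟨C, hC, hcore⟩ := core_bound (N := N) (C₀ := max C₀ 1) hN (by positivity)
  refine ⟨C, hC, ?_⟩
  intro f u G hfm hfb hu htr
  rcases eq_or_ne (volume Ω) 0 with h0 | h0
  · rw [Measure.restrict_eq_zero.mpr h0]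
    simp
  have : IsFiniteMeasure (volume.restrict Ω) := ⟨by simpa using hΩb.measure_lt_top⟩
  have : IsProbabilityMeasure (normMeasure Ω) := ⟨by
    simp [normMeasure, ENNReal.inv_mul_cancel h0 hfin]⟩
  have hinv : (volume Ω)⁻¹ ≠ ⊤ := ENNReal.inv_ne_top.mpr h0
  have hinv0 : (volume Ω)⁻¹ ≠ 0 := ENNReal.inv_ne_zero.mpr hfin
  have hac : normMeasure Ω ≪ volume.restrict Ω := Measure.smul_absolutelyContinuous
  have hac' : volume.restrict Ω ≪ normMeasure Ω := Measure.absolutelyContinuous_smul hinv0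
  have hfL : MemLp f ⊤ (volume.restrict Ω) := ⟨hfm.aestronglyMeasurable, hfb⟩
  have hf2 : MemLp f 2 (volume.restrict Ω) := hfL.mono_exponent le_top
  have hum : AEMeasurable u (volume.restrict Ω) := hu.1.1
  have key : ∀ M : ℝ, (eLpNorm f ⊤ (volume.restrict Ω)).toReal < M →
      eLpNorm u ⊤ (volume.restrict Ω) ≤ ENNReal.ofReal C * ENNReal.ofReal M := by
    intro M hM
    have hM0 : 0 < M := lt_of_le_of_lt ENNReal.toReal_nonneg hM
    have hfM : ∀ᵐ x ∂(volume.restrict Ω), |f x| ≤ M := by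
      filter_upwards [ae_le_eLpNormEssSup (f := f) (μ := volume.restrict Ω)] with x hx
      rw [← eLpNorm_exponent_top] at hx
      have := ENNReal.toReal_mono hfb.ne hx
      rw [toReal_enorm, Real.norm_eq_abs] at this
      linarith
    have hside : ∀ ε : ℝ, ε = 1 ∨ ε = -1 → ∀ᵐ x ∂(volume.restrict Ω), ε * u x ≤ C * M := by
      intro ε hε
      apply hac'.ae_le
      refine hcore (normMeasure Ω) M hM0 (fun x => ε * u x)
        ((hum.const_mul ε).mono_ac hac) ?_ ?_
      · intro c hc
        obtain ⟨hvm, -, hv2, -⟩ := htr ε hε c hc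
        exact (memLp_two_of hvm hv2).smul_measure hinv
      · intro c hc
        have hv := htr ε hε c hc
        refine (hOS _ _ hv).trans ?_
        gcongr ENNReal.ofReal ?_ * ?_ ^ (1/2 : ℝ)
        · exact le_max_left _ _
        · unfold normMeasure
          rw [lintegral_smul_measure, integral_smul_measure, smul_eq_mul, smul_eq_mul,
            mul_left_comm, ENNReal.ofReal_mul ENNReal.toReal_nonneg, ENNReal.ofReal_toReal hinv]
          gcongr
          exact energy_est hBm hf2 hu hfM hε hv
    rw [← ENNReal.ofReal_mul hC.le, eLpNorm_exponent_top]
    apply eLpNormEssSup_le_of_ae_bound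
    filter_upwards [hside 1 (Or.inl rfl), hside (-1) (Or.inr rfl)] with x h1 h2
    rw [Real.norm_eq_abs, abs_le]
    constructor <;> linarith
  have ht : Tendsto (fun M : ℝ => ENNReal.ofReal C * ENNReal.ofReal M)
      (𝓝[>] (eLpNorm f ⊤ (volume.restrict Ω)).toReal)
      (𝓝 (ENNReal.ofReal C * eLpNorm f ⊤ (volume.restrict Ω))) := by
    apply ENNReal.Tendsto.const_mul _ (Or.inr ENNReal.ofReal_ne_top)
    have h5 := (ENNReal.continuous_ofReal.tendsto
      (eLpNorm f ⊤ (volume.restrict Ω)).toReal)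
    rw [ENNReal.ofReal_toReal hfb.ne] at h5
    exact h5.mono_left nhdsWithin_le_nhds
  refine ge_of_tendsto ht ?_
  filter_upwards [self_mem_nhdsWithin] with M hM using key M hM
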